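/- Let f : ℝ^(m+k) → ℝ^k be Lipschitz near (x₀, y₀) with f(x₀, y₀) = z₀. Suppose every ℓ in the Clarke generalized Jacobian ∂f(x₀, y₀) satisfies Ker ℓ ∩ ({0}^m × ℝ^k) = {0}. Then there exist neighbourhoods U of x₀ and V of y₀ and a unique Lipschitz function g : U → V with g(x₀) = y₀ such that f⁻¹(z₀) ∩ (U × V) = graph(g). -/

import Mathlib

open Filter Topology

/-- The Clarke generalized Jacobian: the convex hull of all limits of derivatives
`fderiv ℝ f (u n)` along sequences of differentiability points `u n → a`. -/
noncomputable def clarkeJacobian {E F : Type*} [NormedAddCommGroup E] [NormedSpace ℝ E]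
    [NormedAddCommGroup F] [NormedSpace ℝ F] (f : E → F) (a : E) : Set (E →L[ℝ] F) :=
  convexHull ℝ {L | ∃ u : ℕ → E, (∀ n, DifferentiableAt ℝ f (u n)) ∧
    Tendsto u atTop (𝓝 a) ∧ Tendsto (fun n => fderiv ℝ f (u n)) atTop (𝓝 L)}

theorem IsCompact.convexHull_of_finiteDimensional {E : Type*} [NormedAddCommGroup E]
    [NormedSpace ℝ E] [FiniteDimensional ℝ E] {s : Set E} (hs : IsCompact s) :
    IsCompact (convexHull ℝ s) := by
  let Φ : (n : ℕ) → (Fin n → ℝ) × (Fin n → E) → E := fun n p => ∑ i, p.1 i • p.2 i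
  have hΦ : ∀ n, Continuous (Φ n) := fun n => by fun_prop
  have key : convexHull ℝ s = ⋃ n ∈ Finset.range (Module.finrank ℝ E + 2),
      Φ n '' (stdSimplex ℝ (Fin n) ×ˢ Set.univ.pi fun _ => s) := by
    apply Set.Subset.antisymm
    · intro x hx
      obtain ⟨ι, _, z, w, hz, hind, hw, hw1, hx⟩ := eq_pos_convex_span_of_mem_convexHull hx
      have hcard : Fintype.card ι ≤ Module.finrank ℝ E + 1 :=
        hind.card_le_finrank_succ.trans
          (Nat.succ_le_succ (Submodule.finrank_le _))
      simp only [Set.mem_iUnion, Finset.mem_range]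
      let e := Fintype.equivFin ι
      refine ⟨Fintype.card ι, by omega, (w ∘ e.symm, z ∘ e.symm), ⟨⟨fun i => (hw _).le, ?_⟩,
        fun i _ => hz ⟨_, rfl⟩⟩, ?_⟩
      · rw [← hw1]
        exact e.symm.sum_comp w
      · rw [← hx]
        exact e.symm.sum_comp fun i => w i • z i
    · simp only [Set.iUnion_subset_iff]
      rintro n - _ ⟨⟨w, z⟩, ⟨hw, hz⟩, rfl⟩
      exact (convex_convexHull ℝ s).sum_mem (fun i _ => hw.1 i) hw.2
        fun i _ => subset_convexHull ℝ s (hz i trivial)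
  rw [key]
  exact (Finset.range _).isCompact_biUnion fun n _ =>
    ((isCompact_stdSimplex ℝ (Fin n)).prod (isCompact_univ_pi fun _ => hs)).image (hΦ n)

open MeasureTheory in
/-- Mean value inequality for Lipschitz functions, from an almost everywhere bound on the
directional derivative. -/
theorem LipschitzWith.mul_le_sub_of_le_fderiv {E : Type*} [NormedAddCommGroup E]
    [NormedSpace ℝ E] [FiniteDimensional ℝ E] [MeasurableSpace E] [BorelSpace E]
    (μ : Measure E) [μ.IsAddHaarMeasure] {ψ : E → ℝ} {K : NNReal} (hψ : LipschitzWith K ψ)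
    {s : Set E} (hs : Convex ℝ s) (ho : IsOpen s) {e : E} {c : ℝ}
    (h : ∀ᵐ q ∂μ, q ∈ s → c ≤ fderiv ℝ ψ q e)
    {p : E} {t : ℝ} (ht : 0 ≤ t) (hp : p ∈ s) (hpt : p + t • e ∈ s) :
    c * t ≤ ψ (p + t • e) - ψ p := by
  by_contra! hlt
  obtain ⟨M, hM, hMc⟩ := exists_between hlt
  have hc := hψ.continuous
  have h1 : ∀ᶠ q in 𝓝 p, q ∈ s ∧ q + t • e ∈ s ∧ ψ (q + t • e) - ψ q < M := by
    refine (ho.eventually_mem hp).and (Filter.Eventually.and ?_ ?_)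
    · have : ContinuousAt (fun q => q + t • e) p := by fun_prop
      exact this.eventually (ho.mem_nhds hpt)
    · have : ContinuousAt (fun q => ψ (q + t • e) - ψ q) p := by fun_prop
      exact this.eventually (gt_mem_nhds hM)
  obtain ⟨ε, hε, hB⟩ := Metric.eventually_nhds_iff_ball.1 h1
  set B := Metric.ball p ε with hBdef
  have hBm : MeasurableSet B := measurableSet_ball
  have hBfin : μ B ≠ ⊤ := measure_ball_lt_top.ne
  have hBpos : 0 < μ.real B :=
    ENNReal.toReal_pos (Metric.measure_ball_pos μ p hε).ne' hBfin
  have hint : ∀ τ : ℝ, IntegrableOn (fun q => ψ (q + τ • e)) B μ := fun τ => by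
    have : Continuous fun q => ψ (q + τ • e) := by fun_prop
    exact (this.continuousOn.integrableOn_compact (isCompact_closedBall p ε)).mono_set
      Metric.ball_subset_closedBall
  have hder : ∀ τ : ℝ, Integrable (fun q => fderiv ℝ ψ (q + τ • e) e) (μ.restrict B) ∧
      HasDerivAt (fun τ : ℝ => ∫ q in B, ψ (q + τ • e) ∂μ)
        (∫ q in B, fderiv ℝ ψ (q + τ • e) e ∂μ) τ := fun τ => by
    have hdiff : ∀ᵐ q ∂(μ.restrict B), DifferentiableAt ℝ ψ (q + τ • e) :=
      ae_restrict_of_ae ((measurePreserving_add_right μ (τ • e)).quasiMeasurePreserving.ae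
        hψ.ae_differentiableAt)
    have := hasDerivAt_integral_of_dominated_loc_of_lip (μ := μ.restrict B) (x₀ := τ)
      (F := fun (τ : ℝ) q => ψ (q + τ • e)) (F' := fun q => fderiv ℝ ψ (q + τ • e) e)
      (bound := fun _ => K * ‖e‖) (s := Set.univ) univ_mem
      (Eventually.of_forall fun τ => (hint τ).aestronglyMeasurable) (hint τ)
      (((measurable_fderiv_apply_const ℝ ψ e).comp
        (measurable_add_const (τ • e))).aestronglyMeasurable)
      (Eventually.of_forall fun q => ?_) ?_ ?_
    · exact this
    · refine LipschitzOnWith.of_dist_le_mul fun a _ b _ => (hψ.dist_le_mul _ _).trans ?_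
      rw [dist_add_left, dist_eq_norm, ← sub_smul, norm_smul, dist_eq_norm, Real.coe_nnabs,
        abs_of_nonneg (by positivity)]
      exact le_of_eq (by ring)
    · exact integrableOn_const hBfin
    · filter_upwards [hdiff] with q hq
      have h2 : HasDerivAt (fun τ : ℝ => q + τ • e) e τ := by
        simpa using ((hasDerivAt_id τ).smul_const e).const_add q
      exact hq.hasFDerivAt.comp_hasDerivAt τ h2
  have hmv := Convex.mul_sub_le_image_sub_of_le_deriv (convex_Icc (0 : ℝ) t)
    (f := fun τ : ℝ => ∫ q in B, ψ (q + τ • e) ∂μ) (C := c * μ.real B)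
    (fun τ _ => (hder τ).2.continuousAt.continuousWithinAt)
    (fun τ _ => (hder τ).2.differentiableAt.differentiableWithinAt)
    (fun τ hτ => by
      have hτ' := interior_subset hτ
      rw [(hder τ).2.deriv]
      have : ∫ q in B, c ∂μ ≤ ∫ q in B, fderiv ℝ ψ (q + τ • e) e ∂μ := by
        refine integral_mono_ae (integrableOn_const hBfin) (hder τ).1 ?_
        filter_upwards [ae_restrict_of_ae ((measurePreserving_add_right μ
          (τ • e)).quasiMeasurePreserving.ae h), ae_restrict_mem hBm] with q hq hqB
        refine hq ?_
        obtain ⟨hqs, hqt, -⟩ := hB q hqB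
        rcases ht.eq_or_lt with rfl | ht0
        · have : τ = 0 := le_antisymm hτ'.2 hτ'.1
          simpa [this] using hqs
        · have := hs.add_smul_sub_mem hqs hqt (t := τ / t)
            ⟨div_nonneg hτ'.1 ht, div_le_one_of_le₀ hτ'.2 ht⟩
          rwa [add_sub_cancel_left, smul_smul, div_mul_cancel₀ _ ht0.ne'] at this
      rw [setIntegral_const, smul_eq_mul, mul_comm] at this
      exact this)
    0 ⟨le_rfl, ht⟩ t ⟨ht, le_rfl⟩ ht
  have hup : ∫ q in B, (ψ (q + t • e) - ψ (q + (0 : ℝ) • e)) ∂μ ≤ ∫ q in B, M ∂μ := by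
    refine setIntegral_mono_on ((hint t).sub (hint 0)) (integrableOn_const hBfin) hBm
      fun q hq => ?_
    simpa using (hB q hq).2.2.le
  rw [integral_sub (hint t) (hint 0), setIntegral_const, smul_eq_mul] at hup
  simp only [sub_zero] at hmv
  nlinarith

theorem exists_pos_forall_inner_apply_ge {Y : Type*} [NormedAddCommGroup Y]
    [InnerProductSpace ℝ Y] [FiniteDimensional ℝ Y] {K : Set (Y →L[ℝ] Y)} (hK : IsCompact K)
    (hKc : Convex ℝ K) (hinj : ∀ ℓ ∈ K, ∀ v, ℓ v = 0 → v = 0) :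
    ∃ c > 0, ∀ v : Y, ‖v‖ = 1 → ∃ w : Y, ‖w‖ ≤ 1 ∧ ∀ ℓ ∈ K, c ≤ inner ℝ w (ℓ v) := by
  have hT : IsCompact ((fun p : (Y →L[ℝ] Y) × Y => p.1 p.2) '' (K ×ˢ Metric.sphere 0 1)) :=
    (hK.prod (isCompact_sphere 0 1)).image (by fun_prop)
  have h0 : (0 : Y) ∉ (fun p : (Y →L[ℝ] Y) × Y => p.1 p.2) '' (K ×ˢ Metric.sphere 0 1) := by
    rintro ⟨⟨ℓ, v⟩, ⟨hℓ, hv⟩, hz⟩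
    simp [hinj ℓ hℓ v hz] at hv
  obtain ⟨c, hc, hball⟩ := Metric.isOpen_iff.1 hT.isClosed.isOpen_compl 0 h0
  refine ⟨c, hc, fun v hv => ?_⟩
  rcases K.eq_empty_or_nonempty with rfl | hne
  · exact ⟨0, by simp, by simp⟩
  let A : Set Y := (fun ℓ : Y →L[ℝ] Y => ℓ v) '' K
  have hAc : Convex ℝ A := hKc.linear_image (ContinuousLinearMap.apply ℝ Y v).toLinearMap
  have hA : IsCompact A := hK.image (by fun_prop)
  obtain ⟨a, ha, hmin⟩ := exists_norm_eq_iInf_of_complete_convex (hne.image _) hA.isComplete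
    hAc 0
  rw [norm_eq_iInf_iff_real_inner_le_zero hAc ha] at hmin
  have hca : c ≤ ‖a‖ := by
    by_contra! hlt
    obtain ⟨ℓ, hℓ, rfl⟩ := ha
    exact hball (by simpa using hlt) ⟨(ℓ, v), ⟨hℓ, by simpa using hv⟩, rfl⟩
  have hapos : 0 < ‖a‖ := hc.trans_le hca
  refine ⟨‖a‖⁻¹ • a, by rw [norm_smul, norm_inv, norm_norm, inv_mul_cancel₀ hapos.ne'],
    fun ℓ hℓ => hca.trans ?_⟩
  have := hmin (ℓ v) ⟨ℓ, hℓ, rfl⟩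
  rw [zero_sub, inner_neg_left, inner_sub_right, real_inner_self_eq_norm_sq] at this
  rw [real_inner_smul_left, inv_mul_eq_div, le_div_iff₀ hapos]
  nlinarith

theorem setOf_tendsto_fderiv_eq_preimage_closure {E F : Type*} [NormedAddCommGroup E]
    [NormedSpace ℝ E] [NormedAddCommGroup F] [NormedSpace ℝ F] (f : E → F) (a : E) :
    {L | ∃ u : ℕ → E, (∀ n, DifferentiableAt ℝ f (u n)) ∧
      Tendsto u atTop (𝓝 a) ∧ Tendsto (fun n => fderiv ℝ f (u n)) atTop (𝓝 L)} =
    (fun L : E →L[ℝ] F => (a, L)) ⁻¹'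
      closure ((fun q => (q, fderiv ℝ f q)) '' {q | DifferentiableAt ℝ f q}) := by
  ext L
  simp only [Set.mem_ofPred_eq, Set.mem_preimage, mem_closure_iff_seq_limit]
  constructor
  · rintro ⟨u, hu, ha, hL⟩
    exact ⟨fun n => (u n, fderiv ℝ f (u n)), fun n => ⟨u n, hu n, rfl⟩, ha.prodMk_nhds hL⟩
  · rintro ⟨x, hx, hlim⟩
    choose u hu hux using hx
    obtain rfl : x = fun n => (u n, fderiv ℝ f (u n)) := funext fun n => (hux n).symm
    exact ⟨u, hu, (Prod.tendsto_iff _ _).1 hlim⟩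

theorem isCompact_clarkeJacobian {E F : Type*} [NormedAddCommGroup E] [NormedSpace ℝ E]
    [FiniteDimensional ℝ E] [NormedAddCommGroup F] [NormedSpace ℝ F] [FiniteDimensional ℝ F]
    {f : E → F} {a : E} {C : NNReal} {W : Set E} (hW : W ∈ 𝓝 a) (hf : LipschitzOnWith C f W) :
    IsCompact (clarkeJacobian f a) := by
  refine IsCompact.convexHull_of_finiteDimensional ?_
  refine (isCompact_closedBall (0 : E →L[ℝ] F) C).of_isClosed_subset ?_ ?_
  · rw [setOf_tendsto_fderiv_eq_preimage_closure]
    exact isClosed_closure.preimage (by fun_prop)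
  · rintro L ⟨u, -, ha, hL⟩
    rw [mem_closedBall_zero_iff]
    refine le_of_tendsto hL.norm ?_
    filter_upwards [ha.eventually (eventually_mem_nhds_iff.2 hW)] with n hn
    exact norm_fderiv_le_of_lipschitzOn ℝ hn hf

/-- Upper semicontinuity of the derivative with respect to the Clarke generalized Jacobian. -/
theorem eventually_exists_clarkeJacobian_norm_sub_lt {E F : Type*} [NormedAddCommGroup E]
    [NormedSpace ℝ E] [FiniteDimensional ℝ E] [NormedAddCommGroup F] [NormedSpace ℝ F]
    [FiniteDimensional ℝ F] {f : E → F} {a : E} {C : NNReal} {W : Set E} (hW : W ∈ 𝓝 a)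
    (hf : LipschitzOnWith C f W) {ε : ℝ} (hε : 0 < ε) :
    ∀ᶠ q in 𝓝 a, DifferentiableAt ℝ f q →
      ∃ ℓ ∈ clarkeJacobian f a, ‖fderiv ℝ f q - ℓ‖ < ε := by
  by_contra hcon
  have hfr : ∃ᶠ q in 𝓝 a, (DifferentiableAt ℝ f q ∧
      ∀ ℓ ∈ clarkeJacobian f a, ε ≤ ‖fderiv ℝ f q - ℓ‖) ∧ W ∈ 𝓝 q := by
    refine Frequently.and_eventually ?_ (eventually_mem_nhds_iff.2 hW)
    simpa [Filter.not_eventually] using hcon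
  obtain ⟨u, hu, hP⟩ := exists_seq_forall_of_frequently hfr
  obtain ⟨L, -, φ, hφ, hL⟩ := tendsto_subseq_of_bounded
    (x := fun n => fderiv ℝ f (u n)) (Metric.isBounded_closedBall (x := (0 : E →L[ℝ] F)) (r := C))
    fun n => mem_closedBall_zero_iff.2 (norm_fderiv_le_of_lipschitzOn ℝ (hP n).2 hf)
  have hmem : L ∈ clarkeJacobian f a := subset_convexHull ℝ _
    ⟨u ∘ φ, fun n => (hP _).1.1, hu.comp hφ.tendsto_atTop, hL⟩
  have hlim : Tendsto (fun n => ‖fderiv ℝ f (u (φ n)) - L‖) atTop (𝓝 0) :=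
    tendsto_iff_norm_sub_tendsto_zero.1 hL
  exact absurd (ge_of_tendsto' hlim fun n => (hP (φ n)).1.2 L hmem) hε.not_ge

/-- A uniform lower bound for a pairing with the Clarke generalized Jacobian gives a lower bound
for the increments of the function near the base point, uniformly in the pair of vectors. -/
theorem exists_ball_forall_mul_le_inner_sub {E F : Type*} [NormedAddCommGroup E]
    [NormedSpace ℝ E] [FiniteDimensional ℝ E] [NormedAddCommGroup F] [InnerProductSpace ℝ F]
    [FiniteDimensional ℝ F] {f : E → F} {a : E} {C : NNReal} {W : Set E} (hW : W ∈ 𝓝 a)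
    (hf : LipschitzOnWith C f W) {c : ℝ} (hc : 0 < c) :
    ∃ δ > 0, Metric.ball a δ ⊆ W ∧ ∀ (w : F) (e : E), ‖w‖ ≤ 1 → ‖e‖ ≤ 1 →
      (∀ ℓ ∈ clarkeJacobian f a, c ≤ inner ℝ w (ℓ e)) →
      ∀ (p : E) (t : ℝ), 0 ≤ t → p ∈ Metric.ball a δ → p + t • e ∈ Metric.ball a δ →
        c / 2 * t ≤ inner ℝ w (f (p + t • e) - f p) := by
  obtain ⟨δ, hδ, hball⟩ := Metric.eventually_nhds_iff_ball.1
    ((eventually_exists_clarkeJacobian_norm_sub_lt hW hf (half_pos hc)).and hW)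
  refine ⟨δ, hδ, fun q hq => (hball q hq).2, fun w e hw he hℓ p t ht hp hpt => ?_⟩
  borelize E
  obtain ⟨g, hg, hfg⟩ := LipschitzOnWith.extend_finite_dimension
    (hf.mono fun q hq => (hball q hq).2)
  have hψ := (innerSL ℝ w).lipschitz.comp hg
  have key := hψ.mul_le_sub_of_le_fderiv MeasureTheory.Measure.addHaar (convex_ball a δ)
    Metric.isOpen_ball (e := e) (c := c / 2) ?_ ht hp hpt
  · simpa [inner_sub_right, ← hfg hp, ← hfg hpt] using key
  · filter_upwards [hg.ae_differentiableAt] with q hgq hq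
    have hev : f =ᶠ[𝓝 q] g := by
      filter_upwards [Metric.isOpen_ball.mem_nhds hq] with x hx using hfg hx
    obtain ⟨ℓ, hℓmem, hlt⟩ := (hball q hq).1 (hev.differentiableAt_iff.2 hgq)
    rw [hev.fderiv_eq] at hlt
    have hfd : fderiv ℝ (innerSL ℝ w ∘ g) q e = inner ℝ w (fderiv ℝ g q e) := by
      rw [((innerSL ℝ w).hasFDerivAt.comp q hgq.hasFDerivAt).fderiv]
      rfl
    have hbound : |inner ℝ w ((fderiv ℝ g q - ℓ) e)| ≤ c / 2 :=
      calc |inner ℝ w ((fderiv ℝ g q - ℓ) e)| ≤ ‖w‖ * ‖(fderiv ℝ g q - ℓ) e‖ :=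
            abs_real_inner_le_norm _ _
        _ ≤ 1 * (‖fderiv ℝ g q - ℓ‖ * ‖e‖) := by
            gcongr
            exact ContinuousLinearMap.le_opNorm _ _
        _ ≤ 1 * (c / 2 * 1) := by gcongr
        _ = c / 2 := by ring
    rw [sub_apply, inner_sub_right] at hbound
    rw [hfd]
    linarith [neg_le_of_abs_le hbound, hℓ ℓ hℓmem]

theorem exists_pos_forall_pairing_inr_ge {X Y : Type*} [NormedAddCommGroup X] [NormedSpace ℝ X]
    [NormedAddCommGroup Y] [InnerProductSpace ℝ Y] [FiniteDimensional ℝ Y]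
    {K : Set (X × Y →L[ℝ] Y)} (hK : IsCompact K) (hKc : Convex ℝ K)
    (hker : ∀ ℓ ∈ K, ∀ v : X × Y, ℓ v = 0 → v.1 = 0 → v = 0) :
    ∃ c > 0,
      (∀ v : Y, ‖v‖ = 1 → ∃ w : Y, ‖w‖ ≤ 1 ∧ ∀ ℓ ∈ K, c ≤ inner ℝ w (ℓ (0, v))) ∧
      ∀ w : Y, ‖w‖ = 1 → ∃ v : Y, ‖v‖ ≤ 1 ∧ ∀ ℓ ∈ K, c ≤ inner ℝ w (ℓ (0, v)) := by
  let R : (X × Y →L[ℝ] Y) →L[ℝ] (Y →L[ℝ] Y) :=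
    (ContinuousLinearMap.compL ℝ Y (X × Y) Y).flip (ContinuousLinearMap.inr ℝ X Y)
  let A : (X × Y →L[ℝ] Y) →L[ℝ] (Y →L[ℝ] Y) :=
    (ContinuousLinearMap.adjoint (𝕜 := ℝ) (E := Y)
      (F := Y)).toLinearIsometry.toContinuousLinearMap ∘L R
  have hR : ∀ ℓ v, R ℓ v = ℓ (0, v) := fun ℓ v => rfl
  have hinj : ∀ ℓ ∈ K, ∀ v, R ℓ v = 0 → v = 0 := fun ℓ hℓ v hv =>
    congrArg Prod.snd (hker ℓ hℓ (0, v) hv rfl)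
  have hinjA : ∀ ℓ ∈ K, ∀ v, A ℓ v = 0 → v = 0 := fun ℓ hℓ v hv => by
    have hsurj : Function.Surjective (R ℓ) :=
      LinearMap.injective_iff_surjective.1
        ((injective_iff_map_eq_zero (R ℓ : Y →ₗ[ℝ] Y)).2 (hinj ℓ hℓ))
    obtain ⟨u, hu⟩ := hsurj v
    have : inner ℝ (A ℓ v) u = inner ℝ v (R ℓ u) := ContinuousLinearMap.adjoint_inner_left _ _ _
    rwa [hv, hu, inner_zero_left, eq_comm, inner_self_eq_zero] at this
  obtain ⟨c₁, hc₁, h₁⟩ := exists_pos_forall_inner_apply_ge (hK.image R.continuous)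
    (hKc.linear_image R.toLinearMap) (by rintro _ ⟨ℓ, hℓ, rfl⟩; exact hinj ℓ hℓ)
  obtain ⟨c₂, hc₂, h₂⟩ := exists_pos_forall_inner_apply_ge (hK.image A.continuous)
    (hKc.linear_image A.toLinearMap) (by rintro _ ⟨ℓ, hℓ, rfl⟩; exact hinjA ℓ hℓ)
  refine ⟨min c₁ c₂, lt_min hc₁ hc₂, fun v hv => ?_, fun w hw => ?_⟩
  · obtain ⟨w, hw, h⟩ := h₁ v hv
    exact ⟨w, hw, fun ℓ hℓ => (min_le_left _ _).trans (h _ ⟨ℓ, hℓ, rfl⟩)⟩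
  · obtain ⟨v, hv, h⟩ := h₂ w hw
    refine ⟨v, hv, fun ℓ hℓ => (min_le_right _ _).trans ((h _ ⟨ℓ, hℓ, rfl⟩).trans_eq ?_)⟩
    rw [real_inner_comm]
    exact ContinuousLinearMap.adjoint_inner_left _ _ _

/-- If `h` can be increased at a linear rate in every direction of the target, then `h - z` cannot
have a nonzero local minimum of its norm. -/
theorem eq_of_isLocalMin_norm_sub {Y : Type*} [NormedAddCommGroup Y] [InnerProductSpace ℝ Y]
    {h : Y → Y} {y z : Y} {c : ℝ} {K : NNReal} {s : Set Y} (hs : s ∈ 𝓝 y)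
    (hmin : ∀ y' ∈ s, ‖h y - z‖ ≤ ‖h y' - z‖) (hc : 0 < c) (hlip : LipschitzOnWith K h s)
    (hdir : ∀ w : Y, ‖w‖ = 1 → ∃ v : Y, ‖v‖ ≤ 1 ∧
      ∀ t : ℝ, 0 ≤ t → y + t • v ∈ s → c * t ≤ inner ℝ w (h (y + t • v) - h y)) :
    h y = z := by
  by_contra hne
  set u := h y - z with hu
  have hupos : 0 < ‖u‖ := norm_pos_iff.2 (sub_ne_zero.2 hne)
  obtain ⟨v, hv, hvt⟩ := hdir (-(‖u‖⁻¹ • u)) (by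
    rw [norm_neg, norm_smul, norm_inv, norm_norm, inv_mul_cancel₀ hupos.ne'])
  have hcont : ContinuousAt (fun t : ℝ => y + t • v) 0 := by fun_prop
  have hlim : Tendsto (fun t : ℝ => (K : ℝ) ^ 2 * t) (𝓝 0) (𝓝 0) := by
    have : Continuous fun t : ℝ => (K : ℝ) ^ 2 * t := by fun_prop
    simpa using this.tendsto 0
  have hev : ∀ᶠ t : ℝ in 𝓝[>] 0, (y + t • v ∈ s ∧ (K : ℝ) ^ 2 * t < 2 * c * ‖u‖) ∧ 0 < t :=
    (((hcont.eventually_mem (by simpa using hs)).and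
      (hlim.eventually (gt_mem_nhds (by positivity)))).filter_mono nhdsWithin_le_nhds).and
      self_mem_nhdsWithin
  obtain ⟨t, ⟨hts, htK⟩, ht⟩ := hev.exists
  have h1 := hvt t ht.le hts
  have h2 := hmin _ hts
  set Δ := h (y + t • v) - h y with hΔ
  have h3 : h (y + t • v) - z = u + Δ := by rw [hu, hΔ]; abel
  have h4 : ‖Δ‖ ≤ K * t := by
    refine (hlip.norm_sub_le hts (mem_of_mem_nhds hs)).trans ?_
    rw [add_sub_cancel_left, norm_smul, Real.norm_of_nonneg ht.le]
    gcongr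
    exact mul_le_of_le_one_right ht.le hv
  have h5 : ‖u‖ ^ 2 ≤ ‖u + Δ‖ ^ 2 := by
    rw [h3] at h2
    gcongr
  rw [inner_neg_left, real_inner_smul_left, ← mul_neg, inv_mul_eq_div, le_div_iff₀ hupos] at h1
  rw [norm_add_sq_real] at h5
  have h6 : ‖Δ‖ ^ 2 ≤ (K * t) ^ 2 := by gcongr
  nlinarith

/-- Lipschitz Implicit Function Theorem. -/
theorem lipschitz_implicit_function_theorem (m k : ℕ)
    (f : EuclideanSpace ℝ (Fin m) × EuclideanSpace ℝ (Fin k) → EuclideanSpace ℝ (Fin k))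
    (x₀ : EuclideanSpace ℝ (Fin m)) (y₀ : EuclideanSpace ℝ (Fin k))
    (z₀ : EuclideanSpace ℝ (Fin k))
    (hlip : ∃ C : NNReal, ∃ W ∈ 𝓝 (x₀, y₀), LipschitzOnWith C f W)
    (hval : f (x₀, y₀) = z₀)
    (hker : ∀ ℓ ∈ clarkeJacobian f (x₀, y₀),
      ∀ v : EuclideanSpace ℝ (Fin m) × EuclideanSpace ℝ (Fin k),
        ℓ v = 0 → v.1 = 0 → v = 0) :
    ∃ U ∈ 𝓝 x₀, ∃ V ∈ 𝓝 y₀, ∃ g : EuclideanSpace ℝ (Fin m) → EuclideanSpace ℝ (Fin k),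
      (∃ C : NNReal, LipschitzOnWith C g U) ∧ g x₀ = y₀ ∧ (∀ x ∈ U, g x ∈ V) ∧
      (∀ p ∈ U ×ˢ V, (f p = z₀ ↔ p.2 = g p.1)) ∧
      (∀ g' : EuclideanSpace ℝ (Fin m) → EuclideanSpace ℝ (Fin k),
        (∀ x ∈ U, g' x ∈ V) → (∀ p ∈ U ×ˢ V, (f p = z₀ ↔ p.2 = g' p.1)) →
        ∀ x ∈ U, g' x = g x) := by
  obtain ⟨C, W, hW, hf⟩ := hlip
  obtain ⟨c₀, hc₀, hv₀, hw₀⟩ := exists_pos_forall_pairing_inr_ge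
    (isCompact_clarkeJacobian hW hf) (convex_convexHull ℝ _) hker
  obtain ⟨δ, hδ, hδW, hinc⟩ := exists_ball_forall_mul_le_inner_sub hW hf hc₀
  set c := c₀ / 2 with hcdef
  have hc : 0 < c := half_pos hc₀
  have hmem : ∀ {x y}, x ∈ Metric.ball x₀ δ → y ∈ Metric.ball y₀ δ →
      (x, y) ∈ Metric.ball (x₀, y₀) δ := fun hx hy => by
    rw [← ball_prod_same]
    exact ⟨hx, hy⟩
  have hexp : ∀ x ∈ Metric.ball x₀ δ, ∀ y ∈ Metric.ball y₀ δ, ∀ y' ∈ Metric.ball y₀ δ,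
      c * ‖y' - y‖ ≤ ‖f (x, y') - f (x, y)‖ := by
    intro x hx y hy y' hy'
    rcases eq_or_ne y' y with rfl | hne
    · simp
    have hpos : 0 < ‖y' - y‖ := norm_pos_iff.2 (sub_ne_zero.2 hne)
    have hunit : ‖‖y' - y‖⁻¹ • (y' - y)‖ = 1 := by
      rw [norm_smul, norm_inv, norm_norm, inv_mul_cancel₀ hpos.ne']
    obtain ⟨w, hw, hwℓ⟩ := hv₀ _ hunit
    have hstep : ((x, y) : EuclideanSpace ℝ (Fin m) × EuclideanSpace ℝ (Fin k)) +
        ‖y' - y‖ • (0, ‖y' - y‖⁻¹ • (y' - y)) = (x, y') := by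
      simp [smul_smul, mul_inv_cancel₀ hpos.ne']
    have := hinc w (0, ‖y' - y‖⁻¹ • (y' - y)) hw (by simp [Prod.norm_def, hunit]) hwℓ (x, y)
      ‖y' - y‖ hpos.le (hmem hx hy) (by rw [hstep]; exact hmem hx hy')
    rw [hstep] at this
    refine this.trans ((real_inner_le_norm _ _).trans ?_)
    exact mul_le_of_le_one_left (norm_nonneg _) hw
  have hflip : ∀ p ∈ Metric.ball (x₀, y₀) δ, ∀ q ∈ Metric.ball (x₀, y₀) δ,
      ‖f p - f q‖ ≤ C * ‖p - q‖ := fun p hp q hq => hf.norm_sub_le (hδW hp) (hδW hq)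
  set r := δ / 2 with hr
  have hrpos : 0 < r := half_pos hδ
  have hV : Metric.closedBall y₀ r ⊆ Metric.ball y₀ δ :=
    Metric.closedBall_subset_ball (half_lt_self hδ)
  obtain ⟨ρ, hρ, hρδ, hCρ⟩ : ∃ ρ > 0, ρ ≤ δ ∧ C * ρ < c * r / 2 := by
    refine ⟨min δ (c * r / 2 / (C + 1)), by positivity, min_le_left _ _, ?_⟩
    calc (C : ℝ) * min δ (c * r / 2 / (C + 1)) ≤ C * (c * r / 2 / (C + 1)) := by
          gcongr
          exact min_le_right _ _
      _ < c * r / 2 := by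
          rw [mul_div_assoc', div_lt_iff₀ (by positivity)]
          nlinarith [mul_pos hc hrpos]
  have hU : Metric.ball x₀ ρ ⊆ Metric.ball x₀ δ := Metric.ball_subset_ball hρδ
  have hex : ∀ x ∈ Metric.ball x₀ ρ, ∃ y ∈ Metric.closedBall y₀ r, f (x, y) = z₀ := by
    intro x hx
    have hlipx : LipschitzOnWith C (fun y => f (x, y)) (Metric.closedBall y₀ r) :=
      LipschitzOnWith.of_dist_le_mul fun y hy y' hy' => by
        have := hflip _ (hmem (hU hx) (hV hy)) _ (hmem (hU hx) (hV hy'))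
        simpa [dist_eq_norm, Prod.norm_def] using this
    obtain ⟨y, hy, hmin⟩ := (isCompact_closedBall y₀ r).exists_isMinOn
      ⟨y₀, Metric.mem_closedBall_self hrpos.le⟩
      (f := fun y => ‖f (x, y) - z₀‖) (hlipx.continuousOn.sub continuousOn_const).norm
    have hmin' : ∀ y' ∈ Metric.closedBall y₀ r, ‖f (x, y) - z₀‖ ≤ ‖f (x, y') - z₀‖ :=
      fun y' hy' => hmin hy'
    have hy0 := hmin' y₀ (Metric.mem_closedBall_self hrpos.le)
    have hstart : ‖f (x, y₀) - z₀‖ < c * r / 2 := by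
      rw [← hval]
      refine (hflip _ (hmem (hU hx) (Metric.mem_ball_self hδ)) _
        (Metric.mem_ball_self hδ)).trans_lt (lt_of_le_of_lt ?_ hCρ)
      have : ‖x - x₀‖ ≤ ρ := (mem_ball_iff_norm.1 hx).le
      gcongr
      simpa [Prod.norm_def] using this
    have hyball : y ∈ Metric.ball y₀ r := by
      rw [mem_ball_iff_norm]
      have h1 := hexp x (hU hx) y₀ (Metric.mem_ball_self hδ) y (hV hy)
      have h2 : ‖f (x, y) - f (x, y₀)‖ ≤ ‖f (x, y) - z₀‖ + ‖f (x, y₀) - z₀‖ := by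
        rw [← sub_sub_sub_cancel_right _ _ z₀]
        exact norm_sub_le _ _
      exact lt_of_mul_lt_mul_left (by linarith) hc.le
    refine ⟨y, hy, eq_of_isLocalMin_norm_sub (h := fun y => f (x, y))
      (mem_of_superset (Metric.isOpen_ball.mem_nhds hyball) Metric.ball_subset_closedBall)
      hmin' hc hlipx fun w hw => ?_⟩
    obtain ⟨v, hv, hvℓ⟩ := hw₀ w hw
    refine ⟨v, hv, fun t ht hts => ?_⟩
    have hstep : ((x, y) : EuclideanSpace ℝ (Fin m) × EuclideanSpace ℝ (Fin k)) +
        t • (0, v) = (x, y + t • v) := by simp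
    have := hinc w (0, v) hw.le (by simpa [Prod.norm_def] using hv) hvℓ (x, y) t ht
      (hmem (hU hx) (hV hy)) (by rw [hstep]; exact hmem (hU hx) (hV hts))
    rwa [hstep] at this
  have huniq : ∀ x ∈ Metric.ball x₀ ρ, ∀ y ∈ Metric.closedBall y₀ r,
      ∀ y' ∈ Metric.closedBall y₀ r, f (x, y) = z₀ → f (x, y') = z₀ → y' = y := by
    intro x hx y hy y' hy' h h'
    have := hexp x (hU hx) y (hV hy) y' (hV hy')
    rw [h, h', sub_self, norm_zero] at this
    have h0 : ‖y' - y‖ ≤ 0 := nonpos_of_mul_nonpos_right this hc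
    exact sub_eq_zero.1 (norm_le_zero_iff.1 h0)
  choose! g hgV hgz using hex
  have hx₀ : x₀ ∈ Metric.ball x₀ ρ := Metric.mem_ball_self hρ
  refine ⟨Metric.ball x₀ ρ, Metric.ball_mem_nhds _ hρ, Metric.closedBall y₀ r,
    Metric.closedBall_mem_nhds _ hrpos, g, ⟨Real.toNNReal (C / c), ?_⟩, ?_, hgV, ?_, ?_⟩
  · refine LipschitzOnWith.of_dist_le_mul fun x hx x' hx' => ?_
    rw [Real.coe_toNNReal _ (by positivity), dist_eq_norm, dist_eq_norm, div_mul_eq_mul_div,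
      le_div_iff₀ hc, mul_comm]
    have h1 := hexp x (hU hx) _ (hV (hgV x' hx')) _ (hV (hgV x hx))
    have h2 := hflip _ (hmem (hU hx') (hV (hgV x' hx'))) _ (hmem (hU hx) (hV (hgV x' hx')))
    rw [hgz x' hx', ← hgz x hx] at h2
    refine h1.trans (h2.trans_eq ?_)
    simp [Prod.norm_def, norm_sub_rev]
  · exact huniq x₀ hx₀ y₀ (Metric.mem_closedBall_self hrpos.le) _ (hgV x₀ hx₀) hval (hgz x₀ hx₀)
  · rintro ⟨x, y⟩ ⟨hx, hy⟩
    refine ⟨fun h => huniq x hx _ (hgV x hx) y hy (hgz x hx) h, fun h => ?_⟩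
    change y = g x at h
    rw [h]
    exact hgz x hx
  · intro g' _ hg' x hx
    exact ((hg' (x, g x) ⟨hx, hgV x hx⟩).1 (hgz x hx)).symm
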